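/- arXiv:2008.00161 — 2 statements merged into one kernel-verified Lean document; each statement's English description precedes it below -/
import Mathlib

section
/- Let U and H be finite sets with H nonempty and |U| ≥ |H|, and let M : U × H → ℝ be a nonnegative weight function. Consider the optimization problem P_in: maximize ∑_{(u,h) ∈ U×H} M(u,h)·ν(u,h) over all functions ν : U × H → ℝ satisfying (i) ν(u,h) ≥ 0 for all (u,h), (ii) ∑_{u ∈ U} ν(u,h) = 1 for every h ∈ H, and (iii) for each user u ∈ U, the set {h ∈ H : ν(u,h) > 0} has at most one element. Then the supremum of P_in is attained, and it equals the maximum of ∑_{h ∈ H} M(f(h), h) over all injective functions f : H → U. -/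
/-- A weighted average is bounded by one of the averaged values that carries positive weight. -/
theorem exists_pos_weight_sum_mul_le {ι : Type*} [Fintype ι] (c w : ι → ℝ)
    (hw : ∀ i, 0 ≤ w i) (hsum : ∑ i, w i = 1) :
    ∃ i, 0 < w i ∧ ∑ j, c j * w j ≤ c i := by
  by_contra! hlt
  set S := ∑ j, c j * w j
  obtain ⟨i, -, hi⟩ : ∃ i ∈ Finset.univ, 0 < w i :=
    Finset.exists_lt_of_sum_lt (by simp [hsum])
  have hsumlt : S < ∑ j, S * w j := by
    refine Finset.sum_lt_sum (fun j _ => ?_)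
      ⟨i, Finset.mem_univ i, mul_lt_mul_of_pos_right (hlt i hi) hi⟩
    rcases (hw j).eq_or_lt with hj | hj
    · simp [← hj]
    · exact mul_le_mul_of_nonneg_right (hlt j hj).le hj.le
  rw [← Finset.mul_sum, hsum, mul_one] at hsumlt
  exact hsumlt.false

/-- Every feasible fractional association is dominated by an injective assignment. -/
theorem exists_injective_sum_mul_le {U H : Type*} [Fintype U] [Fintype H] (M ν : U × H → ℝ)
    (hν : ∀ p, 0 ≤ ν p) (hsum : ∀ h, ∑ u, ν (u, h) = 1)
    (hsub : ∀ u, {h : H | 0 < ν (u, h)}.Subsingleton) :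
    ∃ f : H → U, Function.Injective f ∧ ∑ p, M p * ν p ≤ ∑ h, M (f h, h) := by
  choose f hpos hle using fun h =>
    exists_pos_weight_sum_mul_le (fun u => M (u, h)) (fun u => ν (u, h))
      (fun u => hν (u, h)) (hsum h)
  refine ⟨f, fun a b hab => hsub (f a) (hpos a) ?_, ?_⟩
  · rw [hab]
    exact hpos b
  · rw [Fintype.sum_prod_type_right]
    exact Finset.sum_le_sum fun h _ => hle h

/-- Every injective assignment is realized by a feasible fractional association of equal value. -/
theorem exists_association_of_injective {U H : Type*} [Fintype U] [Fintype H] (M : U × H → ℝ)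
    {f : H → U} (hf : Function.Injective f) :
    ∃ ν : U × H → ℝ, (∀ p, 0 ≤ ν p) ∧ (∀ h, ∑ u, ν (u, h) = 1) ∧
      (∀ u, {h : H | 0 < ν (u, h)}.Subsingleton) ∧
      ∑ h, M (f h, h) = ∑ p, M p * ν p := by
  classical
  refine ⟨fun p => if p.1 = f p.2 then 1 else 0, fun p => ?_, fun h => by simp,
    fun u a ha b hb => ?_, by simp [Fintype.sum_prod_type_right]⟩
  · dsimp only
    split_ifs <;> norm_num
  · have eq_of_pos : ∀ h, (0 : ℝ) < (if u = f h then 1 else 0) → u = f h := fun h hh => by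
      by_contra hne
      simp [hne] at hh
    exact hf ((eq_of_pos a ha).symm.trans (eq_of_pos b hb))

/-- Lemma 1 (equivalence of `P_in` and `P_in'`): the fractional user–AP
association problem attains its supremum, and its optimal value equals the
optimal value of the integral assignment problem over injective maps
`f : H → U`. -/
theorem stmt_0 {U H : Type*} [Fintype U] [Fintype H] [Nonempty H]
    (hcard : Fintype.card H ≤ Fintype.card U)
    (M : U × H → ℝ) (hM : ∀ p, 0 ≤ M p) :
    ∃ val : ℝ,
      IsGreatest {s : ℝ | ∃ ν : U × H → ℝ,
          (∀ p, 0 ≤ ν p) ∧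
          (∀ h : H, ∑ u : U, ν (u, h) = 1) ∧
          (∀ u : U, {h : H | 0 < ν (u, h)}.Subsingleton) ∧
          s = ∑ p : U × H, M p * ν p} val ∧
      IsGreatest {s : ℝ | ∃ f : H → U, Function.Injective f ∧
          s = ∑ h : H, M (f h, h)} val := by
  obtain ⟨e⟩ := Function.Embedding.nonempty_of_card_le hcard
  have : Nonempty (H ↪ U) := ⟨e⟩
  obtain ⟨f, hmax⟩ := Finite.exists_max fun f : H ↪ U => ∑ h, M (f h, h)
  refine ⟨∑ h, M (f h, h), ⟨exists_association_of_injective M f.injective, ?_⟩,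
    ⟨f, f.injective, rfl⟩, ?_⟩
  · rintro _ ⟨ν, hν, hsum, hsub, rfl⟩
    obtain ⟨g, hg, hle⟩ := exists_injective_sum_mul_le M ν hν hsum hsub
    exact hle.trans (hmax ⟨g, hg⟩)
  · rintro _ ⟨g, hg, rfl⟩
    exact hmax ⟨g, hg⟩
end

section
/- Let ι be a finite type and let q, a, m : ι → ℝ be functions with q(i) ≥ 0, a(i) ≥ 0, m(i) ≥ 0 for all i, constants A_max ≥ 0 and μ_max ≥ 0 with a(i) ≤ A_max and m(i) ≤ μ_max for all i, and suppose the slack condition a(i) − m(i) ≤ −ε holds for all i ∈ ι, where ε > 0. Define L(x) = (1/2) ∑_{i ∈ ι} x(i)² and q'(i) = max(q(i) − m(i), 0) + a(i). Then L(q') − L(q) ≤ (|ι|/2)·(μ_max² + A_max²) − ε · ∑_{i ∈ ι} q(i). -/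
/-- One-queue drift bound: a queue with backlog `q`, service `m` and arrivals `a`. -/
theorem sq_max_sub_add_le {q m a : ℝ} (hq : 0 ≤ q) (hm : 0 ≤ m) (ha : 0 ≤ a) :
    (max (q - m) 0 + a) ^ 2 ≤ q ^ 2 + m ^ 2 + a ^ 2 + 2 * q * (a - m) := by
  rcases max_cases (q - m) 0 with ⟨h, -⟩ | ⟨h, -⟩ <;> rw [h]
  · nlinarith [mul_nonneg hm ha]
  · nlinarith [mul_nonneg hq ha, sq_nonneg (q - m)]

/-- Slater-type drift bound (deterministic core of Lemmas 5 and 7): under the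
slack condition `a i − m i ≤ −ε` for all `i`, the Lyapunov drift satisfies
`L q' − L q ≤ (|ι|/2)(μmax² + Amax²) − ε ∑ i, q i`. -/
theorem stmt_7 {ι : Type*} [Fintype ι] (q a m : ι → ℝ)
    (hq : ∀ i, 0 ≤ q i) (ha : ∀ i, 0 ≤ a i) (hm : ∀ i, 0 ≤ m i)
    (Amax μmax : ℝ) (hAmax : 0 ≤ Amax) (hμmax : 0 ≤ μmax)
    (haA : ∀ i, a i ≤ Amax) (hmμ : ∀ i, m i ≤ μmax)
    (ε : ℝ) (hε : 0 < ε) (hslack : ∀ i, a i - m i ≤ -ε)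
    (L : (ι → ℝ) → ℝ) (hL : ∀ x : ι → ℝ, L x = (1 / 2) * ∑ i, (x i) ^ 2)
    (q' : ι → ℝ) (hq' : ∀ i, q' i = max (q i - m i) 0 + a i) :
    L q' - L q ≤ ((Fintype.card ι : ℝ) / 2) * (μmax ^ 2 + Amax ^ 2)
      - ε * ∑ i, q i := by
  have hdrift : ∀ i, q' i ^ 2 ≤ q i ^ 2 + (μmax ^ 2 + Amax ^ 2) - 2 * ε * q i := fun i => by
    rw [hq' i]
    have hmsq : m i ^ 2 ≤ μmax ^ 2 := pow_le_pow_left₀ (hm i) (hmμ i) 2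
    have hasq : a i ^ 2 ≤ Amax ^ 2 := pow_le_pow_left₀ (ha i) (haA i) 2
    linarith [sq_max_sub_add_le (hq i) (hm i) (ha i),
      mul_le_mul_of_nonneg_left (hslack i) (hq i)]
  have hsum := Finset.sum_le_sum fun i (_ : i ∈ Finset.univ) => hdrift i
  rw [Finset.sum_sub_distrib, Finset.sum_add_distrib, ← Finset.mul_sum, Finset.sum_const,
    Finset.card_univ, nsmul_eq_mul] at hsum
  rw [hL, hL]
  linarith
end
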